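/- Assume q = p is prime. Let d, N ≥ 1 and k ∈ ℕ^d, and assume ℓ_p(N) ≥ p and d(p−1) ≤ ℓ_p(N) − p. Then the polynomial Σ_{a∈A_{+,d}} a(t)^N·a^{k} ∈ 𝔽_p[t] is nonzero and its degree in t satisfies N(d−1) < deg_t Σ_{a∈A_{+,d}} a(t)^N·a^{k} ≤ N·d. -/

import Mathlib

noncomputable section

open Polynomial

/-- The monic polynomial of degree `d` in `θ` with lower-order coefficients `c`;
as `c` runs through `Fin d → 𝔽_p` this runs through `A_{+,d}`. -/
def monicOfDeg (p : ℕ) [Fact p.Prime] (d : ℕ) (c : Fin d → ZMod p) : Polynomial (ZMod p) :=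
  X ^ d + ∑ i : Fin d, C (c i) * X ^ (i : ℕ)

/-- The sum of the base-`p` digits of `n`. -/
def digitSum (p n : ℕ) : ℕ := (Nat.digits p n).sum

/-- Remove one copy of the smallest power of `p` occurring in the base-`p` expansion of `n`. -/
def dropUnit (p n : ℕ) : ℕ := n - p ^ padicValNat p n

section DigitSum

variable {p : ℕ}

lemma digitSum_zero : digitSum p 0 = 0 := by simp [digitSum]

lemma dropUnit_le (n : ℕ) : dropUnit p n ≤ n := Nat.sub_le _ _

lemma dropUnit_zero : dropUnit p 0 = 0 := Nat.le_zero.1 (dropUnit_le 0)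

lemma dropUnit_add {n : ℕ} (hn : n ≠ 0) : dropUnit p n + p ^ padicValNat p n = n :=
  Nat.sub_add_cancel (Nat.le_of_dvd (Nat.pos_of_ne_zero hn) pow_padicValNat_dvd)

lemma dropUnit_of_not_dvd {n : ℕ} (h : ¬ p ∣ n) : dropUnit p n = n - 1 := by
  rw [dropUnit, padicValNat.eq_zero_of_not_dvd h, pow_zero]

lemma iterate_dropUnit_le (R n : ℕ) : (dropUnit p)^[R] n ≤ n := by
  induction R with
  | zero => rfl
  | succ R ih =>
    rw [Function.iterate_succ_apply']
    exact (dropUnit_le _).trans ih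

lemma iterate_dropUnit_antitone {R S : ℕ} (h : R ≤ S) (n : ℕ) :
    (dropUnit p)^[S] n ≤ (dropUnit p)^[R] n := by
  obtain ⟨k, rfl⟩ := Nat.exists_eq_add_of_le' h
  rw [Function.iterate_add_apply]
  exact iterate_dropUnit_le _ _

variable [hp : Fact p.Prime]

lemma digitSum_add_factorial (n : ℕ) :
    digitSum p n + (p - 1) * padicValNat p n.factorial = n := by
  rw [sub_one_mul_padicValNat_factorial n]
  exact Nat.add_sub_of_le (Nat.digit_sum_le p n)

/-- Kummer's theorem without truncated subtraction. -/
lemma digitSum_add_choose (x y : ℕ) :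
    digitSum p (x + y) + (p - 1) * padicValNat p ((x + y).choose y) =
      digitSum p x + digitSum p y := by
  have h := congrArg (padicValNat p) (Nat.choose_mul_factorial_mul_factorial
    (Nat.le_add_left y x))
  rw [padicValNat.mul (mul_ne_zero (Nat.choose_pos (Nat.le_add_left y x)).ne'
    (Nat.factorial_ne_zero _)) (Nat.factorial_ne_zero _),
    padicValNat.mul (Nat.choose_pos (Nat.le_add_left y x)).ne' (Nat.factorial_ne_zero _),
    Nat.add_sub_cancel] at h
  have hx := digitSum_add_factorial (p := p) x
  have hy := digitSum_add_factorial (p := p) y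
  have hxy := digitSum_add_factorial (p := p) (x + y)
  rw [← h] at hxy
  simp only [mul_add] at hxy
  omega

lemma digitSum_add_le (x y : ℕ) : digitSum p (x + y) ≤ digitSum p x + digitSum p y :=
  (Nat.le_add_right _ _).trans (digitSum_add_choose x y).le

lemma digitSum_add_eq_iff (x y : ℕ) :
    digitSum p (x + y) = digitSum p x + digitSum p y ↔ ¬ p ∣ (x + y).choose y := by
  have h := digitSum_add_choose (p := p) x y
  have h1 : 0 < p - 1 := Nat.sub_pos_of_lt hp.out.one_lt
  rw [dvd_iff_padicValNat_ne_zero (Nat.choose_pos (Nat.le_add_left y x)).ne', not_not]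
  constructor
  · intro h'
    have : (p - 1) * padicValNat p ((x + y).choose y) = 0 := by omega
    exact (Nat.mul_eq_zero.1 this).resolve_left h1.ne'
  · intro h'
    rw [h'] at h
    omega

lemma digitSum_mod_add_div (n : ℕ) : digitSum p n = n % p + digitSum p (n / p) := by
  rcases Nat.eq_zero_or_pos n with rfl | hn
  · simp [digitSum]
  · simp [digitSum, Nat.digits_def' hp.out.one_lt hn]

lemma digitSum_pow_mul (v n : ℕ) : digitSum p (p ^ v * n) = digitSum p n := by
  rcases Nat.eq_zero_or_pos n with rfl | hn
  · simp
  · simp [digitSum, Nat.digits_base_pow_mul hp.out.one_lt hn]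

lemma digitSum_mul (n : ℕ) : digitSum p (p * n) = digitSum p n := by
  simpa using digitSum_pow_mul (p := p) 1 n

lemma digitSum_pow (v : ℕ) : digitSum p (p ^ v) = 1 := by
  have h := digitSum_pow_mul (p := p) v 1
  rw [mul_one] at h
  rw [h, digitSum, Nat.digits_of_lt p 1 one_ne_zero hp.out.one_lt, List.sum_singleton]

lemma digitSum_eq_zero_iff {n : ℕ} : digitSum p n = 0 ↔ n = 0 := by
  refine ⟨fun h => ?_, fun h => by rw [h, digitSum_zero]⟩
  induction n using Nat.strong_induction_on with
  | _ n ih =>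
    by_contra hn
    rw [digitSum_mod_add_div] at h
    have h1 := ih (n / p) (Nat.div_lt_self (Nat.pos_of_ne_zero hn) hp.out.one_lt) (by omega)
    have h2 := Nat.mod_add_div n p
    rw [h1] at h2
    omega

/-- If there is no carry in `x + y` and `p ∣ x + y`, then `p ∣ x`. -/
lemma dvd_of_digitSum_add {x y : ℕ} (h : digitSum p (x + y) = digitSum p x + digitSum p y)
    (hd : p ∣ x + y) : p ∣ x := by
  obtain ⟨m, hm⟩ := hd
  by_contra hx
  have h2 := hp.out.two_le
  have hxm : 0 < x % p := Nat.pos_of_ne_zero fun h0 => hx (Nat.dvd_of_mod_eq_zero h0)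
  have hxy : (x % p + y % p) % p = 0 := by
    rw [← Nat.add_mod, hm, Nat.mul_mod_right]
  have hxl := Nat.mod_lt x hp.out.pos
  have hyl := Nat.mod_lt y hp.out.pos
  have hsum : x % p + y % p = p := by
    obtain ⟨c, hc⟩ := Nat.dvd_of_mod_eq_zero hxy
    have hc1 : c = 1 := by
      rcases c with _ | _ | c
      · omega
      · rfl
      · nlinarith
    rw [hc, hc1, mul_one]
  have hmeq : m = x / p + y / p + 1 := by
    have h3 := Nat.mod_add_div x p
    have h4 := Nat.mod_add_div y p
    refine Nat.eq_of_mul_eq_mul_left hp.out.pos ?_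
    rw [← hm]
    simp only [mul_add]
    omega
  have h5 := digitSum_mod_add_div (p := p) x
  have h6 := digitSum_mod_add_div (p := p) y
  have h7 := digitSum_add_le (p := p) (x / p + y / p) 1
  have h8 := digitSum_add_le (p := p) (x / p) (y / p)
  have h9 : digitSum p 1 = 1 := by simpa using digitSum_pow (p := p) 0
  rw [hm, digitSum_mul, hmeq] at h
  omega

lemma dropUnit_pow_mul (v n : ℕ) : dropUnit p (p ^ v * n) = p ^ v * dropUnit p n := by
  rcases eq_or_ne n 0 with rfl | hn
  · simp [dropUnit_zero]
  · rw [dropUnit, dropUnit, padicValNat.mul (pow_ne_zero _ hp.out.ne_zero) hn,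
      padicValNat.prime_pow, pow_add, Nat.mul_sub]

lemma dropUnit_mul (n : ℕ) : dropUnit p (p * n) = p * dropUnit p n := by
  simpa using dropUnit_pow_mul (p := p) 1 n

lemma sub_one_mod {n : ℕ} (h : n % p ≠ 0) : (n - 1) % p = n % p - 1 ∧ (n - 1) / p = n / p := by
  have h1 := Nat.mod_add_div n p
  have h2 := Nat.mod_lt n hp.out.pos
  have h3 : n - 1 = (n % p - 1) + p * (n / p) := by omega
  rw [h3, Nat.add_mul_mod_self_left, Nat.add_mul_div_left _ _ hp.out.pos,
    Nat.mod_eq_of_lt (by omega), Nat.div_eq_of_lt (by omega), zero_add]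
  exact ⟨rfl, rfl⟩

lemma dropUnit_mod (n : ℕ) : dropUnit p n % p = n % p - 1 := by
  by_cases h : p ∣ n
  · obtain ⟨m, rfl⟩ := h
    simp [dropUnit_mul]
  · rw [dropUnit_of_not_dvd h]
    exact (sub_one_mod fun h0 => h (Nat.dvd_of_mod_eq_zero h0)).1

lemma digitSum_dropUnit (n : ℕ) : digitSum p (dropUnit p n) = digitSum p n - 1 := by
  induction n using Nat.strong_induction_on with
  | _ n ih =>
    by_cases h : p ∣ n
    · obtain ⟨m, rfl⟩ := h
      rcases Nat.eq_zero_or_pos m with rfl | hm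
      · simp [dropUnit_zero, digitSum_zero]
      · rw [dropUnit_mul, digitSum_mul, digitSum_mul]
        exact ih m (lt_mul_of_one_lt_left hm hp.out.one_lt)
    · have h0 : n % p ≠ 0 := fun h0 => h (Nat.dvd_of_mod_eq_zero h0)
      obtain ⟨h1, h2⟩ := sub_one_mod h0
      rw [dropUnit_of_not_dvd h, digitSum_mod_add_div, digitSum_mod_add_div n, h1, h2]
      omega

lemma digitSum_iterate_dropUnit (R n : ℕ) :
    digitSum p ((dropUnit p)^[R] n) = digitSum p n - R := by
  induction R with
  | zero => rfl
  | succ R ih => rw [Function.iterate_succ_apply', digitSum_dropUnit, ih, Nat.sub_sub]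

lemma iterate_dropUnit_pow_mul (v R n : ℕ) :
    (dropUnit p)^[R] (p ^ v * n) = p ^ v * (dropUnit p)^[R] n := by
  induction R with
  | zero => rfl
  | succ R ih => rw [Function.iterate_succ_apply', ih, dropUnit_pow_mul,
      Function.iterate_succ_apply']

lemma iterate_dropUnit_mod (R n : ℕ) : (dropUnit p)^[R] n % p = n % p - R := by
  induction R with
  | zero => rfl
  | succ R ih => rw [Function.iterate_succ_apply', dropUnit_mod, ih, Nat.sub_sub]

/-- Removing units never produces carries. -/
lemma exists_iterate_dropUnit_add {R n : ℕ} (h : R ≤ digitSum p n) :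
    ∃ y, (dropUnit p)^[R] n + y = n ∧ digitSum p y = R := by
  induction R with
  | zero => exact ⟨0, rfl, digitSum_zero⟩
  | succ R ih =>
    obtain ⟨y, hy, hyR⟩ := ih (by omega)
    have hne : (dropUnit p)^[R] n ≠ 0 := by
      rw [Ne, ← digitSum_eq_zero_iff (p := p), digitSum_iterate_dropUnit]
      omega
    have hadd := dropUnit_add (p := p) hne
    rw [← Function.iterate_succ_apply' (dropUnit p), Nat.succ_eq_add_one] at hadd
    have hsum : (dropUnit p)^[R + 1] n +
        (p ^ padicValNat p ((dropUnit p)^[R] n) + y) = n := by omega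
    refine ⟨_, hsum, ?_⟩
    have h1 := digitSum_add_le (p := p) (p ^ padicValNat p ((dropUnit p)^[R] n)) y
    rw [digitSum_pow] at h1
    have h2 := digitSum_add_le (p := p) ((dropUnit p)^[R + 1] n)
      (p ^ padicValNat p ((dropUnit p)^[R] n) + y)
    rw [hsum, digitSum_iterate_dropUnit] at h2
    omega

/-- A unit of the summand `y` of a carry-free sum can be exchanged for the smallest unit of
the sum without decreasing the other summand. -/
lemma exists_exchange {x y : ℕ} (h : digitSum p (x + y) = digitSum p x + digitSum p y)
    (hy : y ≠ 0) : ∃ x' y', x' + y' = dropUnit p (x + y) ∧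
      digitSum p (x' + y') = digitSum p x' + digitSum p y' ∧ x ≤ x' ∧
      digitSum p y' = digitSum p y - 1 := by
  induction hn : x + y using Nat.strong_induction_on generalizing x y with
  | _ n ih =>
    subst hn
    have hpos : digitSum p y ≠ 0 := fun h0 => hy (digitSum_eq_zero_iff.1 h0)
    have hdrop := digitSum_dropUnit (p := p) (x + y)
    by_cases hd : p ∣ x + y
    · obtain ⟨x, rfl⟩ := dvd_of_digitSum_add h hd
      obtain ⟨y, rfl⟩ := (Nat.dvd_add_right (Dvd.intro x rfl)).1 hd
      have hy0 : 0 < y := Nat.pos_of_ne_zero fun h0 => hy (by simp [h0])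
      rw [← mul_add] at h hd ⊢
      simp only [digitSum_mul] at h ⊢
      obtain ⟨x', y', h1, h2, h3, h4⟩ := ih (x + y) (by nlinarith [hp.out.two_le]) h hy0.ne' rfl
      refine ⟨p * x', p * y', ?_, ?_, Nat.mul_le_mul_left p h3, ?_⟩
      · rw [dropUnit_mul, ← h1, mul_add]
      · rw [← mul_add, digitSum_mul, digitSum_mul, digitSum_mul, h2]
      · rw [digitSum_mul, h4]
    · rw [dropUnit_of_not_dvd hd] at hdrop ⊢
      by_cases hyd : p ∣ y
      · have hxd : ¬ p ∣ x := fun hxd => hd (dvd_add hxd hyd)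
        have hx0 : x ≠ 0 := fun h0 => hxd (h0 ▸ dvd_zero p)
        have hadd := dropUnit_add (p := p) hy
        have hx1 := digitSum_dropUnit (p := p) x
        have hy1 := digitSum_dropUnit (p := p) y
        have hxpos : digitSum p x ≠ 0 := fun h0 => hx0 (digitSum_eq_zero_iff.1 h0)
        rw [dropUnit_of_not_dvd hxd] at hx1
        have hpp : 0 < p ^ padicValNat p y := pow_pos hp.out.pos _
        have hs : x - 1 + p ^ padicValNat p y + dropUnit p y = x + y - 1 := by omega
        have h1 := digitSum_add_le (p := p) (x - 1) (p ^ padicValNat p y)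
        rw [digitSum_pow] at h1
        have h2 := digitSum_add_le (p := p) (x - 1 + p ^ padicValNat p y) (dropUnit p y)
        refine ⟨_, _, hs, ?_, by omega, hy1⟩
        rw [hs] at h2 ⊢
        omega
      · have hy1 := digitSum_dropUnit (p := p) y
        rw [dropUnit_of_not_dvd hyd] at hy1
        have hs : x + (y - 1) = x + y - 1 := by omega
        refine ⟨_, _, hs, ?_, le_rfl, hy1⟩
        rw [hs]
        omega

/-- In a carry-free sum, a summand whose complement has at least `R` units is at most what is
left after removing the `R` smallest units. -/
lemma le_iterate_dropUnit {R x y : ℕ} (h : digitSum p (x + y) = digitSum p x + digitSum p y)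
    (hR : R ≤ digitSum p y) : x ≤ (dropUnit p)^[R] (x + y) := by
  induction R generalizing x y with
  | zero => exact Nat.le_add_right _ _
  | succ R ih =>
    have hy : y ≠ 0 := by
      rintro rfl
      rw [digitSum_zero] at hR
      omega
    obtain ⟨x', y', h1, h2, h3, h4⟩ := exists_exchange h hy
    rw [Function.iterate_succ_apply, ← h1]
    exact h3.trans (ih h2 (by omega))

lemma iterate_dropUnit_le_iterate {r R x y : ℕ}
    (h : digitSum p (x + y) = digitSum p x + digitSum p y) (hr : r ≤ digitSum p y) :
    (dropUnit p)^[R] x ≤ (dropUnit p)^[R] ((dropUnit p)^[r] (x + y)) := by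
  rw [← Function.iterate_add_apply]
  rcases le_total R (digitSum p x) with hR | hR
  · obtain ⟨z, hz, hzR⟩ := exists_iterate_dropUnit_add hR
    have hs : (dropUnit p)^[R] x + (z + y) = x + y := by omega
    have h1 := digitSum_add_le (p := p) z y
    have h2 := digitSum_add_le (p := p) ((dropUnit p)^[R] x) (z + y)
    have h3 := digitSum_iterate_dropUnit (p := p) R x
    rw [hs] at h2
    have h4 := le_iterate_dropUnit (p := p) (R := R + r) (x := (dropUnit p)^[R] x) (y := z + y)
      (by rw [hs]; omega) (by omega)
    rwa [hs] at h4
  · have : (dropUnit p)^[R] x = 0 := by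
      rw [← digitSum_eq_zero_iff (p := p), digitSum_iterate_dropUnit]
      omega
    rw [this]
    exact Nat.zero_le _

lemma pow_succ_dvd_iterate_dropUnit (n : ℕ) :
    p ^ (padicValNat p n + 1) ∣ (dropUnit p)^[p - 1] n := by
  obtain ⟨m, hm⟩ := pow_padicValNat_dvd (p := p) (n := n)
  nth_rw 2 [hm]
  rw [iterate_dropUnit_pow_mul, pow_succ]
  refine mul_dvd_mul_left _ (Nat.dvd_of_mod_eq_zero ?_)
  rw [iterate_dropUnit_mod]
  have := Nat.mod_lt m hp.out.pos
  omega

/-- After removing `p - 1` further units, the smallest remaining unit has at least doubled. -/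
lemma add_iterate_dropUnit_le {n R : ℕ} (h : R + (p - 1) ≤ digitSum p n) :
    n + (dropUnit p)^[R + (p - 1)] n ≤ 2 * (dropUnit p)^[R] n := by
  induction R with
  | zero =>
    have := iterate_dropUnit_le (p := p) (p - 1) n
    simp only [zero_add, Function.iterate_zero, id]
    omega
  | succ R ih =>
    have ih := ih (by omega)
    have hne : (dropUnit p)^[R] n ≠ 0 := by
      rw [Ne, ← digitSum_eq_zero_iff (p := p), digitSum_iterate_dropUnit]
      omega
    have hne' : (dropUnit p)^[R + (p - 1)] n ≠ 0 := by
      rw [Ne, ← digitSum_eq_zero_iff (p := p), digitSum_iterate_dropUnit]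
      omega
    have h1 := dropUnit_add (p := p) hne
    have h2 := dropUnit_add (p := p) hne'
    have hdvd := pow_succ_dvd_iterate_dropUnit (p := p) ((dropUnit p)^[R] n)
    rw [← Function.iterate_add_apply, add_comm (p - 1) R] at hdvd
    have hv := (padicValNat_dvd_iff_le hne').1 hdvd
    have hpow := Nat.pow_le_pow_right hp.out.pos hv
    rw [pow_succ] at hpow
    have h3 := Nat.mul_le_mul_left (p ^ padicValNat p ((dropUnit p)^[R] n)) hp.out.two_le
    rw [add_right_comm, Function.iterate_succ_apply', Function.iterate_succ_apply']
    omega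

lemma mul_lt_sum_iterate_dropUnit {n d : ℕ} (h : (d + 1) * (p - 1) ≤ digitSum p n) :
    n * d + (dropUnit p)^[(d + 1) * (p - 1)] n <
      ∑ j ∈ Finset.range d, (dropUnit p)^[(j + 1) * (p - 1)] n + n := by
  have hp1 : 0 < p - 1 := Nat.sub_pos_of_lt hp.out.one_lt
  induction d with
  | zero =>
    have hne : n ≠ 0 := by
      rintro rfl
      rw [digitSum_zero] at h
      omega
    have h1 := dropUnit_add (p := p) hne
    have h2 : 0 < p ^ padicValNat p n := pow_pos hp.out.pos _
    have h3 := iterate_dropUnit_antitone (p := p) hp1 n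
    rw [Nat.succ_eq_add_one, zero_add, Function.iterate_one] at h3
    simp only [zero_add, one_mul, mul_zero, Finset.range_zero, Finset.sum_empty]
    omega
  | succ d ih =>
    have he : (d + 1 + 1) * (p - 1) = (d + 1) * (p - 1) + (p - 1) := by ring
    rw [he] at h ⊢
    have ih := ih (by omega)
    have h1 := add_iterate_dropUnit_le h
    rw [Finset.sum_range_succ, mul_add, mul_one]
    omega

end DigitSum

/-- The least `s` such that `s + k` is a positive multiple of `p - 1`. -/
def minUnits (p k : ℕ) : ℕ := sInf {s | 0 < s + k ∧ p - 1 ∣ s + k}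

section MinUnits

lemma exists_minUnits (p k : ℕ) [hp : Fact p.Prime] :
    ∃ s ≤ p - 1, 0 < s + k ∧ p - 1 ∣ s + k := by
  have hp1 : 0 < p - 1 := Nat.sub_pos_of_lt hp.out.one_lt
  have h1 := Nat.mod_lt k hp1
  have h2 := Nat.mod_add_div k (p - 1)
  refine ⟨p - 1 - k % (p - 1), Nat.sub_le _ _, by omega, 1 + k / (p - 1), ?_⟩
  rw [mul_add, mul_one]
  omega

lemma minUnits_le (p k : ℕ) [Fact p.Prime] : minUnits p k ≤ p - 1 := by
  obtain ⟨s, hs, h⟩ := exists_minUnits p k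
  exact (Nat.sInf_le h).trans hs

lemma minUnits_spec (p k : ℕ) [Fact p.Prime] :
    0 < minUnits p k + k ∧ p - 1 ∣ minUnits p k + k := by
  obtain ⟨s, -, h⟩ := exists_minUnits p k
  exact Nat.sInf_mem (s := {s | 0 < s + k ∧ p - 1 ∣ s + k}) ⟨s, h⟩

variable {p : ℕ} [hp : Fact p.Prime]

lemma dvd_digitSum_add_iff (n k : ℕ) : p - 1 ∣ digitSum p n + k ↔ p - 1 ∣ n + k := by
  have h := digitSum_add_factorial (p := p) n
  have h' : n + k = (digitSum p n + k) + (p - 1) * padicValNat p n.factorial := by omega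
  rw [h']
  exact (Nat.dvd_add_left (Dvd.intro _ rfl)).symm

lemma digitSum_add_pos_iff (n k : ℕ) : 0 < digitSum p n + k ↔ 0 < n + k := by
  have h := digitSum_eq_zero_iff (p := p) (n := n)
  omega

lemma minUnits_le_digitSum {n k : ℕ} (h0 : 0 < n + k) (h : p - 1 ∣ n + k) :
    minUnits p k ≤ digitSum p n :=
  Nat.sInf_le ⟨(digitSum_add_pos_iff n k).2 h0, (dvd_digitSum_add_iff n k).2 h⟩

end MinUnits

section PowerSum

variable {p : ℕ}

/-- The degree of `twistedPowerSum p d N k` when the base-`p` digit sum of `N` is large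
enough. -/
def greedyDegree (p : ℕ) : (d : ℕ) → ℕ → (Fin d → ℕ) → ℕ
  | 0, _, _ => 0
  | d + 1, N, k => (dropUnit p)^[minUnits p (k 0)] N +
      greedyDegree p d ((dropUnit p)^[minUnits p (k 0)] N) (Fin.tail k)

lemma greedyDegree_mono {d x y : ℕ} (k : Fin d → ℕ)
    (h : ∀ R, (dropUnit p)^[R] x ≤ (dropUnit p)^[R] y) :
    greedyDegree p d x k ≤ greedyDegree p d y k := by
  induction d generalizing x y with
  | zero => rfl
  | succ d ih =>
    refine add_le_add (h _) (ih _ fun R => ?_)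
    rw [← Function.iterate_add_apply, ← Function.iterate_add_apply]
    exact h _

lemma greedyDegree_le (d N : ℕ) (k : Fin d → ℕ) : greedyDegree p d N k ≤ N * d := by
  induction d generalizing N with
  | zero => rfl
  | succ d ih =>
    have h1 := iterate_dropUnit_le (p := p) (minUnits p (k 0)) N
    have h2 := ih ((dropUnit p)^[minUnits p (k 0)] N) (Fin.tail k)
    have h3 := Nat.mul_le_mul_right d h1
    rw [greedyDegree, mul_add, mul_one]
    omega

variable [hp : Fact p.Prime]

lemma sum_zmod_pow (n : ℕ) :
    ∑ a : ZMod p, a ^ n = if 0 < n ∧ p - 1 ∣ n then -1 else 0 := by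
  rcases Nat.eq_zero_or_pos n with rfl | hn
  · simp
  · have h := FiniteField.sum_pow_units (ZMod p) n
    rw [ZMod.card] at h
    simp only [hn, true_and]
    rw [← h, ← Finset.sum_subset (Finset.subset_univ (Finset.univ.filter fun a : ZMod p => a ≠ 0))]
    · symm
      refine Finset.sum_bij (fun u _ => (u : ZMod p)) ?_ ?_ ?_ ?_
      · intro u _
        simp
      · intro u _ v _ huv
        exact Units.ext huv
      · intro a ha
        exact ⟨Units.mk0 a (by simpa using ha), Finset.mem_univ _, rfl⟩
      · intro u _
        rfl
    · intro a _ ha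
      have : a = 0 := by simpa using ha
      rw [this, zero_pow hn.ne']

lemma monicOfDeg_cons (d : ℕ) (a : ZMod p) (c : Fin d → ZMod p) :
    monicOfDeg p (d + 1) (Fin.cons a c) = X * monicOfDeg p d c + C a := by
  simp only [monicOfDeg, Fin.sum_univ_succ, Fin.cons_zero, Fin.cons_succ, Fin.val_zero, pow_zero,
    Fin.val_succ, mul_one, mul_add, Finset.mul_sum]
  rw [pow_succ', add_assoc, add_comm (C a)]
  congr 2
  exact Finset.sum_congr rfl fun i _ => by ring

/-- The sum of `a(t) ^ N * a ^ k` over the monic polynomials `a` of degree `d`. -/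
def twistedPowerSum (p : ℕ) [Fact p.Prime] (d N : ℕ) (k : Fin d → ℕ) : Polynomial (ZMod p) :=
  ∑ c : Fin d → ZMod p, (∏ n : Fin d, c n ^ k n) • monicOfDeg p d c ^ N

lemma twistedPowerSum_zero (N : ℕ) (k : Fin 0 → ℕ) : twistedPowerSum p 0 N k = 1 := by
  simp [twistedPowerSum, monicOfDeg]

lemma twistedPowerSum_succ (d N : ℕ) (k : Fin (d + 1) → ℕ) :
    twistedPowerSum p (d + 1) N k = ∑ x ∈ Finset.range (N + 1),
      C ((N.choose x : ZMod p) * ∑ a : ZMod p, a ^ (N - x + k 0)) *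
        (X ^ x * twistedPowerSum p d x (Fin.tail k)) := by
  have h : ∀ (a : ZMod p) (c : Fin d → ZMod p),
      (∏ n : Fin (d + 1), (Fin.cons a c : Fin (d + 1) → ZMod p) n ^ k n) •
        monicOfDeg p (d + 1) (Fin.cons a c) ^ N = ∑ x ∈ Finset.range (N + 1),
          C ((N.choose x : ZMod p) * a ^ (N - x + k 0)) *
            (X ^ x * (∏ n : Fin d, c n ^ Fin.tail k n) • monicOfDeg p d c ^ x) := by
    intro a c
    rw [monicOfDeg_cons, add_pow, Finset.smul_sum]
    refine Finset.sum_congr rfl fun x _ => ?_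
    simp only [Fin.prod_univ_succ, Fin.cons_zero, Fin.cons_succ, Fin.tail, smul_eq_C_mul,
      map_mul, map_pow, map_natCast, mul_pow, pow_add]
    ring
  rw [twistedPowerSum, ← (Fin.consEquiv fun _ => ZMod p).sum_comp, Fintype.sum_prod_type]
  refine (Finset.sum_congr rfl fun a _ => (Finset.sum_congr rfl fun c _ => h a c).trans
    Finset.sum_comm).trans (Finset.sum_comm.trans (Finset.sum_congr rfl fun x _ => ?_))
  simp only [twistedPowerSum, Finset.mul_sum, map_sum, Finset.sum_mul]
  rw [Finset.sum_comm]

lemma sum_iterate_le_greedyDegree {d N r s : ℕ} (k : Fin d → ℕ) (hrs : r ≤ s) :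
    ∑ j ∈ Finset.range d, (dropUnit p)^[s + (j + 1) * (p - 1)] N ≤
      greedyDegree p d ((dropUnit p)^[r] N) k := by
  induction d generalizing r s with
  | zero => simp
  | succ d ih =>
    have hle : minUnits p (k 0) + r ≤ s + (p - 1) := by
      have := minUnits_le p (k 0)
      omega
    rw [greedyDegree, Finset.sum_range_succ', ← Function.iterate_add_apply, add_comm]
    refine add_le_add ?_ ?_
    · rw [zero_add, one_mul]
      exact iterate_dropUnit_antitone hle N
    · refine le_of_eq_of_le (Finset.sum_congr rfl fun j _ => ?_) (ih (Fin.tail k) hle)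
      rw [add_assoc s, add_mul (j + 1), one_mul, add_comm (p - 1)]

/-- If `x` contributes to the expansion of `twistedPowerSum p (d + 1) N k`, then there is no carry
in `x + (N - x)`, and `N - x` has at least `minUnits p (k 0)` units. -/
lemma of_coeff_ne_zero {N x k : ℕ} (hx : x ≤ N)
    (h : (N.choose x : ZMod p) * ∑ a : ZMod p, a ^ (N - x + k) ≠ 0) :
    digitSum p (x + (N - x)) = digitSum p x + digitSum p (N - x) ∧
      minUnits p k ≤ digitSum p (N - x) := by
  obtain ⟨h1, h2⟩ := mul_ne_zero_iff.1 h
  rw [Ne, CharP.cast_eq_zero_iff (ZMod p) p] at h1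
  rw [sum_zmod_pow, ne_eq, ite_eq_right_iff, Classical.not_imp] at h2
  refine ⟨?_, minUnits_le_digitSum h2.1.1 h2.1.2⟩
  rwa [digitSum_add_eq_iff, Nat.add_sub_cancel' hx, Nat.choose_symm hx]

lemma coeff_ne_zero_iterate {N k : ℕ} (h : minUnits p k ≤ digitSum p N) :
    (N.choose ((dropUnit p)^[minUnits p k] N) : ZMod p) *
      ∑ a : ZMod p, a ^ (N - (dropUnit p)^[minUnits p k] N + k) ≠ 0 := by
  have hle := iterate_dropUnit_le (p := p) (minUnits p k) N
  obtain ⟨y, hy, hyd⟩ := exists_iterate_dropUnit_add h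
  have hyN : N - (dropUnit p)^[minUnits p k] N = y := by omega
  refine mul_ne_zero ?_ ?_
  · rw [Ne, CharP.cast_eq_zero_iff (ZMod p) p, ← Nat.choose_symm hle, hyN]
    have h1 := digitSum_add_eq_iff (p := p) ((dropUnit p)^[minUnits p k] N) y
    rw [hy] at h1
    rw [← h1, digitSum_iterate_dropUnit, hyd]
    omega
  · have hs := minUnits_spec p k
    rw [← hyd, digitSum_add_pos_iff, dvd_digitSum_add_iff] at hs
    rw [hyN, sum_zmod_pow, if_pos hs]
    exact neg_ne_zero.2 one_ne_zero

lemma natDegree_twistedPowerSum_le (d N : ℕ) (k : Fin d → ℕ) :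
    (twistedPowerSum p d N k).natDegree ≤ greedyDegree p d N k := by
  induction d generalizing N with
  | zero => simp [twistedPowerSum_zero]
  | succ d ih =>
    rw [twistedPowerSum_succ]
    refine natDegree_sum_le_of_forall_le _ _ fun x hx => ?_
    have hx := Finset.mem_range_succ_iff.1 hx
    by_cases h : (N.choose x : ZMod p) * ∑ a : ZMod p, a ^ (N - x + k 0) = 0
    · simp [h]
    · obtain ⟨h1, h2⟩ := of_coeff_ne_zero hx h
      have h3 := fun R => iterate_dropUnit_le_iterate (R := R) h1 h2
      rw [Nat.add_sub_cancel' hx] at h3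
      refine (natDegree_C_mul_le _ _).trans (natDegree_mul_le.trans ?_)
      rw [natDegree_X_pow]
      exact add_le_add (h3 0) ((ih x (Fin.tail k)).trans (greedyDegree_mono _ h3))

lemma coeff_twistedPowerSum_ne_zero (d N : ℕ) (k : Fin d → ℕ)
    (h : d * (p - 1) ≤ digitSum p N) :
    (twistedPowerSum p d N k).coeff (greedyDegree p d N k) ≠ 0 := by
  induction d generalizing N with
  | zero => simp [twistedPowerSum_zero, greedyDegree]
  | succ d ih =>
    have hle := iterate_dropUnit_le (p := p) (minUnits p (k 0)) N
    have hmin := minUnits_le p (k 0)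
    rw [add_mul, one_mul] at h
    rw [twistedPowerSum_succ, finsetSum_coeff,
      Finset.sum_eq_single ((dropUnit p)^[minUnits p (k 0)] N)]
    · rw [coeff_C_mul, greedyDegree, add_comm (_^[_] N), coeff_X_pow_mul]
      refine mul_ne_zero (coeff_ne_zero_iterate (by omega)) (ih _ _ ?_)
      rw [digitSum_iterate_dropUnit]
      omega
    · intro x hx hne
      have hx := Finset.mem_range_succ_iff.1 hx
      by_cases h : (N.choose x : ZMod p) * ∑ a : ZMod p, a ^ (N - x + k 0) = 0
      · simp [h]
      · obtain ⟨h1, h2⟩ := of_coeff_ne_zero hx h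
        have h3 := fun R => iterate_dropUnit_le_iterate (R := R) h1 h2
        rw [Nat.add_sub_cancel' hx] at h3
        refine coeff_eq_zero_of_natDegree_lt ((natDegree_C_mul_le _ _).trans_lt
          (natDegree_mul_le.trans_lt ?_))
        rw [natDegree_X_pow]
        exact add_lt_add_of_lt_of_le (lt_of_le_of_ne (h3 0) hne)
          ((natDegree_twistedPowerSum_le d x (Fin.tail k)).trans (greedyDegree_mono _ h3))
    · intro hx
      exact absurd (Finset.mem_range_succ_iff.2 hle) hx

end PowerSum

/-- Let `q = p` be prime, `d, N ≥ 1` and `k ∈ ℕ^d`, with `ℓ_p(N) ≥ p` and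
`d(p-1) ≤ ℓ_p(N) - p`.  Then the polynomial `Σ_{a ∈ A_{+,d}} a(t)^N·a^k ∈ 𝔽_p[t]` is
nonzero and `N(d-1) < deg_t Σ_{a ∈ A_{+,d}} a(t)^N·a^k ≤ N·d`. -/
theorem degree_of_twisted_power_sum (p : ℕ) [Fact p.Prime] (d N : ℕ)
    (hd : 1 ≤ d) (hN : 1 ≤ N) (k : Fin d → ℕ)
    (hl : p ≤ (Nat.digits p N).sum)
    (hdl : d * (p - 1) ≤ (Nat.digits p N).sum - p) :
    (∑ c : Fin d → ZMod p, (∏ n : Fin d, c n ^ k n) • monicOfDeg p d c ^ N) ≠ 0 ∧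
    N * (d - 1) <
      (∑ c : Fin d → ZMod p, (∏ n : Fin d, c n ^ k n) • monicOfDeg p d c ^ N).natDegree ∧
    (∑ c : Fin d → ZMod p, (∏ n : Fin d, c n ^ k n) • monicOfDeg p d c ^ N).natDegree ≤
      N * d := by
  change twistedPowerSum p d N k ≠ 0 ∧ N * (d - 1) < (twistedPowerSum p d N k).natDegree ∧
    (twistedPowerSum p d N k).natDegree ≤ N * d
  have hp2 := (Fact.out : p.Prime).two_le
  have hdig : (d + 1) * (p - 1) ≤ digitSum p N := by
    rw [digitSum, add_mul, one_mul]
    omega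
  have hcoeff := coeff_twistedPowerSum_ne_zero d N k
    ((Nat.mul_le_mul_right _ (Nat.le_succ d)).trans hdig)
  have hdeg : (twistedPowerSum p d N k).natDegree = greedyDegree p d N k :=
    le_antisymm (natDegree_twistedPowerSum_le d N k) (le_natDegree_of_ne_zero hcoeff)
  refine ⟨fun h => hcoeff (by rw [h, coeff_zero]), ?_, hdeg ▸ greedyDegree_le d N k⟩
  have h1 := mul_lt_sum_iterate_dropUnit hdig
  have h2 := sum_iterate_le_greedyDegree (p := p) (N := N) k (le_refl 0)
  simp only [zero_add, Function.iterate_zero, id] at h2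
  rw [hdeg, Nat.mul_sub, mul_one]
  have h3 : N ≤ N * d := Nat.le_mul_of_pos_right N hd
  omega

end
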